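/- arXiv:1803.06023 — 3 statements merged into one kernel-verified Lean document; each statement's English description precedes it below -/
import Mathlib

section
/- Let r ≥ 1, let a : Fin r × Fin r → ℝ and b : Fin r → ℝ be Runge–Kutta coefficients satisfying the symplecticity condition bᵢ a_{ij} + b_j a_{ji} = bᵢ b_j for all i, j. Let Δt, Δx > 0, let K, L be skew-symmetric real n×n matrices, let S : ℝⁿ → ℝ be twice continuously differentiable, and set K̃ = (1/Δt)K − (1/Δx)L and L̃ = (1/Δt)K + (1/Δx)L. Fix stage values Z : Fin r × Fin r → ℝⁿ. Suppose two tuples of variations (u_ℓ, u^b, U, X, T, u_r, u^t) and (v_ℓ, v^b, V, X', T', v_r, v^t), with U, V, X, X', T, T' : Fin r × Fin r → ℝⁿ and the others Fin r → ℝⁿ, each satisfy the linearized diamond-scheme equations: Uᵢʲ = u_ℓʲ + Σₖ a_{ik} Xₖʲ, Uᵢʲ = u^bᵢ + Σₖ a_{jk} Tᵢᵏ, Hess S(Zᵢʲ) Uᵢʲ = K̃ Tᵢʲ + L̃ Xᵢʲ, u_rⁱ = u_ℓⁱ + Σₖ bₖ Xₖⁱ, u^tᵢ = u^bᵢ + Σₖ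 bₖ Tᵢᵏ (and similarly for the v-tuple). Then the discrete symplectic conservation law holds: (1/Δt) Σᵢ bᵢ [ (u^tᵢ)ᵀK(v^tᵢ) + (u_rⁱ)ᵀK(v_rⁱ) − (u_ℓⁱ)ᵀK(v_ℓⁱ) − (u^bᵢ)ᵀK(v^bᵢ) ] + (1/Δx) Σᵢ bᵢ [ (u_rⁱ)ᵀL(v_rⁱ) + (u^bᵢ)ᵀL(v^bᵢ) − (u^tᵢ)ᵀL(v^tᵢ) − (u_ℓⁱ)ᵀL(v_ℓⁱ) ] = 0. -/
open Matrix

/-- The gradient of `S : ℝⁿ → ℝ` as a vector of partial derivatives. -/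
noncomputable def gradS {n : ℕ} (S : (Fin n → ℝ) → ℝ) (p : Fin n → ℝ) : Fin n → ℝ :=
  fun i => fderiv ℝ S p (Pi.single i 1)

/-- The Hessian matrix of `S : ℝⁿ → ℝ`. -/
noncomputable def hessS {n : ℕ} (S : (Fin n → ℝ) → ℝ) (p : Fin n → ℝ) :
    Matrix (Fin n) (Fin n) ℝ :=
  Matrix.of fun i j => fderiv ℝ (fun q => gradS S q j) p (Pi.single i 1)

/-- The Hessian matrix of a `C²` function is symmetric. -/
theorem hessS_transpose {n : ℕ} {S : (Fin n → ℝ) → ℝ} (hS : ContDiff ℝ 2 S) (p : Fin n → ℝ) :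
    (hessS S p)ᵀ = hessS S p := by
  have hd : DifferentiableAt ℝ (fderiv ℝ S) p :=
    ((hS.fderiv_right (m := 1) (by norm_num)).differentiable (by norm_num)) p
  have key (i j : Fin n) :
      hessS S p i j = fderiv ℝ (fderiv ℝ S) p (Pi.single i 1) (Pi.single j 1) := by
    simp only [hessS, gradS, of_apply]
    rw [fderiv_clm_apply hd (differentiableAt_const _)]
    simp
  have hsymm : IsSymmSndFDerivAt ℝ S p := hS.contDiffAt.isSymmSndFDerivAt (by simp)
  ext i j
  rw [transpose_apply, key, key]
  exact hsymm.eq _ _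

/-- A symplectic Runge–Kutta step changes a bilinear quantity by the quadrature of its
derivative at the stages. -/
theorem bilin_rungeKutta_step {ι E : Type*} [Fintype ι] [AddCommGroup E] [Module ℝ E]
    (B : E →ₗ[ℝ] E →ₗ[ℝ] ℝ) {a : Matrix ι ι ℝ} {b : ι → ℝ}
    (hsymp : ∀ i j, b i * a i j + b j * a j i = b i * b j)
    {u₀ u₁ v₀ v₁ : E} {U V X Y : ι → E}
    (hU : ∀ i, U i = u₀ + ∑ k, a i k • X k) (hV : ∀ i, V i = v₀ + ∑ k, a i k • Y k)
    (hu : u₁ = u₀ + ∑ k, b k • X k) (hv : v₁ = v₀ + ∑ k, b k • Y k) :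
    B u₁ v₁ - B u₀ v₀ = ∑ i, b i * (B (X i) (V i) + B (U i) (Y i)) := by
  have hdouble : ∑ i, ∑ k, b i * (b k * B (X i) (Y k)) =
      ∑ i, ∑ k, b i * (a i k * B (X i) (Y k)) + ∑ i, ∑ k, b i * (a i k * B (X k) (Y i)) := by
    rw [Finset.sum_comm (f := fun i k => b i * (a i k * B (X k) (Y i))),
      ← Finset.sum_add_distrib]
    refine Finset.sum_congr rfl fun i _ => ?_
    rw [← Finset.sum_add_distrib]
    refine Finset.sum_congr rfl fun k _ => ?_
    linear_combination -B (X i) (Y k) * hsymp i k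
  simp only [hU, hV, hu, hv, map_add, map_sum, map_smul, LinearMap.add_apply,
    LinearMap.sum_apply, LinearMap.smul_apply, smul_eq_mul, mul_add, Finset.sum_add_distrib,
    Finset.mul_sum] at hdouble ⊢
  rw [Finset.sum_comm (f := fun i k => b i * (b k * B (X k) (Y i)))]
  have hcomm : ∑ i, ∑ k, b k * (b i * B (X i) (Y k)) = ∑ i, ∑ k, b i * (b k * B (X i) (Y k)) :=
    Finset.sum_congr rfl fun i _ => Finset.sum_congr rfl fun k _ => by ring
  linarith

theorem dotProduct_mulVec_eq_neg_of_transpose_eq_neg {ι : Type*} [Fintype ι]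
    {M : Matrix ι ι ℝ} (hM : Mᵀ = -M) (x y : ι → ℝ) : x ⬝ᵥ (M *ᵥ y) = -(y ⬝ᵥ (M *ᵥ x)) := by
  rw [dotProduct_mulVec, ← mulVec_transpose, hM, neg_mulVec, neg_dotProduct, dotProduct_comm]

theorem dotProduct_mulVec_comm_of_transpose_eq {ι : Type*} [Fintype ι]
    {M : Matrix ι ι ℝ} (hM : Mᵀ = M) (x y : ι → ℝ) : x ⬝ᵥ (M *ᵥ y) = y ⬝ᵥ (M *ᵥ x) := by
  rw [dotProduct_mulVec, ← mulVec_transpose, hM, dotProduct_comm]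

/-- Discrete multisymplectic conservation law of the diamond scheme: if two
tuples of variations each satisfy the linearized diamond-scheme stage and
update equations (with a symplectic Runge–Kutta method `(a, b)`, skew-symmetric
`K, L`, and `K̃ = (1/Δt)K − (1/Δx)L`, `L̃ = (1/Δt)K + (1/Δx)L`), then
`(1/Δt) Σᵢ bᵢ (ωᵢᵗ + ωᵣⁱ − ωₗⁱ − ωᵢᵇ) + (1/Δx) Σᵢ bᵢ (κᵣⁱ + κᵢᵇ − κᵢᵗ − κₗⁱ) = 0`,
where `ω = uᵀKv` and `κ = uᵀLv` at the corresponding edge nodes. -/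
theorem diamond_scheme_discrete_conservation_law
    {r n : ℕ} (hr : 1 ≤ r)
    (a : Matrix (Fin r) (Fin r) ℝ) (b : Fin r → ℝ)
    (hsymp : ∀ i j : Fin r, b i * a i j + b j * a j i = b i * b j)
    (Δt Δx : ℝ) (hΔt : 0 < Δt) (hΔx : 0 < Δx)
    (K L : Matrix (Fin n) (Fin n) ℝ) (hK : Kᵀ = -K) (hL : Lᵀ = -L)
    (S : (Fin n → ℝ) → ℝ) (hS : ContDiff ℝ 2 S)
    (K' L' : Matrix (Fin n) (Fin n) ℝ)
    (hK' : K' = (1 / Δt) • K - (1 / Δx) • L)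
    (hL' : L' = (1 / Δt) • K + (1 / Δx) • L)
    (Z : Fin r × Fin r → Fin n → ℝ)
    -- first tuple of variations
    (uℓ ub ur ut : Fin r → Fin n → ℝ)
    (U X T : Fin r × Fin r → Fin n → ℝ)
    (hU1 : ∀ i j, U (i, j) = uℓ j + ∑ k, a i k • X (k, j))
    (hU2 : ∀ i j, U (i, j) = ub i + ∑ k, a j k • T (i, k))
    (hU3 : ∀ i j, hessS S (Z (i, j)) *ᵥ U (i, j) = K' *ᵥ T (i, j) + L' *ᵥ X (i, j))
    (hur : ∀ i, ur i = uℓ i + ∑ k, b k • X (k, i))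
    (hut : ∀ i, ut i = ub i + ∑ k, b k • T (i, k))
    -- second tuple of variations
    (vℓ vb vr vt : Fin r → Fin n → ℝ)
    (V X' T' : Fin r × Fin r → Fin n → ℝ)
    (hV1 : ∀ i j, V (i, j) = vℓ j + ∑ k, a i k • X' (k, j))
    (hV2 : ∀ i j, V (i, j) = vb i + ∑ k, a j k • T' (i, k))
    (hV3 : ∀ i j, hessS S (Z (i, j)) *ᵥ V (i, j) = K' *ᵥ T' (i, j) + L' *ᵥ X' (i, j))
    (hvr : ∀ i, vr i = vℓ i + ∑ k, b k • X' (k, i))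
    (hvt : ∀ i, vt i = vb i + ∑ k, b k • T' (i, k)) :
    (1 / Δt) * ∑ i, b i *
        (ut i ⬝ᵥ (K *ᵥ vt i) + ur i ⬝ᵥ (K *ᵥ vr i)
          - uℓ i ⬝ᵥ (K *ᵥ vℓ i) - ub i ⬝ᵥ (K *ᵥ vb i))
      + (1 / Δx) * ∑ i, b i *
        (ur i ⬝ᵥ (L *ᵥ vr i) + ub i ⬝ᵥ (L *ᵥ vb i)
          - ut i ⬝ᵥ (L *ᵥ vt i) - uℓ i ⬝ᵥ (L *ᵥ vℓ i)) = 0 := by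
  have hK'skew : K'ᵀ = -K' := by
    rw [hK', transpose_sub, transpose_smul, transpose_smul, hK, hL]; module
  have hL'skew : L'ᵀ = -L' := by
    rw [hL', transpose_add, transpose_smul, transpose_smul, hK, hL]; module
  have hstepT (i) := bilin_rungeKutta_step (Matrix.toLinearMap₂' ℝ K') hsymp
    (hU2 i) (hV2 i) (hut i) (hvt i)
  have hstepX (j) := bilin_rungeKutta_step (Matrix.toLinearMap₂' ℝ L') hsymp
    (hU1 · j) (hV1 · j) (hur j) (hvr j)
  simp only [Matrix.toLinearMap₂'_apply'] at hstepT hstepX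
  have hlocal (i j) :
      (T (i, j) ⬝ᵥ (K' *ᵥ V (i, j)) + U (i, j) ⬝ᵥ (K' *ᵥ T' (i, j)))
        + (X (i, j) ⬝ᵥ (L' *ᵥ V (i, j)) + U (i, j) ⬝ᵥ (L' *ᵥ X' (i, j))) = 0 := by
    have h := dotProduct_mulVec_comm_of_transpose_eq (hessS_transpose hS (Z (i, j)))
      (U (i, j)) (V (i, j))
    rw [hU3, hV3, dotProduct_add, dotProduct_add] at h
    rw [dotProduct_mulVec_eq_neg_of_transpose_eq_neg hK'skew (T (i, j)),
      dotProduct_mulVec_eq_neg_of_transpose_eq_neg hL'skew (X (i, j))]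
    linarith
  calc
    _ = ∑ i, b i * (ut i ⬝ᵥ (K' *ᵥ vt i) - ub i ⬝ᵥ (K' *ᵥ vb i))
        + ∑ j, b j * (ur j ⬝ᵥ (L' *ᵥ vr j) - uℓ j ⬝ᵥ (L' *ᵥ vℓ j)) := by
      rw [Finset.mul_sum, Finset.mul_sum, ← Finset.sum_add_distrib, ← Finset.sum_add_distrib]
      refine Finset.sum_congr rfl fun i _ => ?_
      simp only [hK', hL', sub_mulVec, add_mulVec, smul_mulVec, dotProduct_sub, dotProduct_add,
        dotProduct_smul, smul_eq_mul]
      ring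
    _ = 0 := by
      simp only [hstepT, hstepX, Finset.mul_sum]
      rw [Finset.sum_comm (f := fun j i => b j * (b i * (X (i, j) ⬝ᵥ (L' *ᵥ V (i, j))
        + U (i, j) ⬝ᵥ (L' *ᵥ X' (i, j))))), ← Finset.sum_add_distrib]
      refine Finset.sum_eq_zero fun i _ => ?_
      rw [← Finset.sum_add_distrib]
      refine Finset.sum_eq_zero fun j _ => ?_
      linear_combination b i * b j * hlocal i j
end

section
/- Let K, L be skew-symmetric real n×n matrices, S : ℝⁿ → ℝ differentiable, Δt, Δx > 0, and b ∈ ℝ. Let z : ℝ² → ℝⁿ be a continuously differentiable solution of K zₜ + L zₓ = ∇S(z), and define z̃(x̃, t̃) = z( (Δx/2)(x̃ − t̃) + b, (Δt/2) x̃ t̃ ). Then at every point (x̃, t̃) with x̃ + t̃ ≠ 0, z̃ satisfies K̃ z̃_t̃ + L̃ z̃_x̃ = ∇S(z̃), where K̃ = (2/(Δx Δt (x̃+t̃))) (Δx K − t̃ Δt L) and L̃ = (2/(Δx Δt (x̃+t̃))) (Δx K + x̃ Δt L). -/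
open Matrix

/-- Partial derivative in the second (time-like) coordinate. -/
noncomputable def partialT {E : Type*} [NormedAddCommGroup E] [NormedSpace ℝ E]
    (u : ℝ × ℝ → E) (p : ℝ × ℝ) : E :=
  fderiv ℝ u p (0, 1)

/-- Partial derivative in the first (space-like) coordinate. -/
noncomputable def partialX {E : Type*} [NormedAddCommGroup E] [NormedSpace ℝ E]
    (u : ℝ × ℝ → E) (p : ℝ × ℝ) : E :=
  fderiv ℝ u p (1, 0)

/-- The partial derivatives of a pullback along the square-to-triangle map. -/
theorem partials_comp_diamond {E : Type*} [NormedAddCommGroup E] [NormedSpace ℝ E]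
    {z z' : ℝ × ℝ → E} (hz : Differentiable ℝ z) (Δt Δx b : ℝ)
    (hz' : ∀ p : ℝ × ℝ, z' p = z (Δx / 2 * (p.1 - p.2) + b, Δt / 2 * (p.1 * p.2)))
    (p : ℝ × ℝ) :
    let q := (Δx / 2 * (p.1 - p.2) + b, Δt / 2 * (p.1 * p.2))
    partialT z' p = (Δt / 2 * p.1) • partialT z q - (Δx / 2) • partialX z q ∧
      partialX z' p = (Δt / 2 * p.2) • partialT z q + (Δx / 2) • partialX z q := by
  intro q
  have h1 : HasFDerivAt (fun p : ℝ × ℝ => p.1) (ContinuousLinearMap.fst ℝ ℝ ℝ) p :=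
    hasFDerivAt_fst
  have h2 : HasFDerivAt (fun p : ℝ × ℝ => p.2) (ContinuousLinearMap.snd ℝ ℝ ℝ) p :=
    hasFDerivAt_snd
  have hq := (((h1.sub h2).const_mul (Δx / 2)).add_const b).prodMk
    ((h1.mul h2).const_mul (Δt / 2))
  have hfd := (HasFDerivAt.comp p (hz q).hasFDerivAt hq).fderiv
  have hcomp : z' = z ∘ fun p : ℝ × ℝ =>
      (Δx / 2 * (p.1 - p.2) + b, Δt / 2 * (p.1 * p.2)) := funext hz'
  have hsplit (a c : ℝ) : fderiv ℝ z q (a, c) = c • partialT z q + a • partialX z q := by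
    rw [partialT, partialX, ← map_smul, ← map_smul, ← map_add]
    simp
  constructor
  · rw [partialT, hcomp]
    refine (DFunLike.congr_fun hfd _).trans ?_
    simp [hsplit, sub_eq_add_neg]
  · rw [partialX, hcomp]
    refine (DFunLike.congr_fun hfd _).trans ?_
    simp [hsplit]

/-- Under the square-to-triangle map `x = (Δx/2)(x̃ − t̃) + b`, `t = (Δt/2) x̃ t̃`,
a `C¹` solution `z` of `K zₜ + L zₓ = ∇S(z)` pulls back to a solution `z̃` of
`K̃ z̃_t̃ + L̃ z̃_x̃ = ∇S(z̃)` at every point with `x̃ + t̃ ≠ 0`, where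
`K̃ = (2/(Δx Δt (x̃+t̃))) (Δx K − t̃ Δt L)` and
`L̃ = (2/(Δx Δt (x̃+t̃))) (Δx K + x̃ Δt L)`. -/
theorem diamond_initialization_change_of_variables
    {n : ℕ} (K L : Matrix (Fin n) (Fin n) ℝ)
    (hK : Kᵀ = -K) (hL : Lᵀ = -L)
    (S : (Fin n → ℝ) → ℝ) (hS : Differentiable ℝ S)
    (Δt Δx : ℝ) (hΔt : 0 < Δt) (hΔx : 0 < Δx) (b : ℝ)
    (z : ℝ × ℝ → Fin n → ℝ) (hz : ContDiff ℝ 1 z)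
    (hsol : ∀ p : ℝ × ℝ, K *ᵥ partialT z p + L *ᵥ partialX z p = gradS S (z p))
    (z' : ℝ × ℝ → Fin n → ℝ)
    (hz' : ∀ p : ℝ × ℝ, z' p = z (Δx / 2 * (p.1 - p.2) + b, Δt / 2 * (p.1 * p.2))) :
    ∀ p : ℝ × ℝ, p.1 + p.2 ≠ 0 →
      ((2 / (Δx * Δt * (p.1 + p.2))) • (Δx • K - (p.2 * Δt) • L)) *ᵥ partialT z' p
        + ((2 / (Δx * Δt * (p.1 + p.2))) • (Δx • K + (p.1 * Δt) • L)) *ᵥ partialX z' p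
      = gradS S (z' p) := by
  intro p hp
  obtain ⟨hT, hX⟩ := partials_comp_diamond (hz.differentiable one_ne_zero) Δt Δx b hz' p
  rw [hT, hX, hz' p, ← hsol]
  simp only [smul_mulVec, sub_mulVec, add_mulVec, mulVec_add, mulVec_sub, mulVec_smul]
  ext i
  simp only [Pi.add_apply, Pi.sub_apply, Pi.smul_apply, smul_eq_mul]
  field_simp
  ring
end

section
/- Let Δx, Δt > 0 and b ∈ ℝ. The image of the unit square [0,1] × [0,1] under the map Ψ(x̃, t̃) = ( (Δx/2)(x̃ − t̃) + b, (Δt/2) x̃ t̃ ) equals the closed triangle with vertices (b − Δx/2, 0), (b + Δx/2, 0), and (b, Δt/2), i.e., the convex hull of these three points. -/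
/-- Membership in a closed triangle in terms of barycentric coordinates. -/
theorem mem_convexHull_triple {E : Type*} [AddCommGroup E] [Module ℝ E] {x y z p : E} :
    p ∈ convexHull ℝ {x, y, z} ↔
      ∃ u v w : ℝ, 0 ≤ u ∧ 0 ≤ v ∧ 0 ≤ w ∧ u + v + w = 1 ∧ u • x + v • y + w • z = p := by
  constructor
  · rw [convexHull_insert (Set.insert_nonempty _ _), convexHull_pair, mem_convexJoin]
    rintro ⟨_, rfl, _, ⟨c, d, hc, hd, hcd, rfl⟩, ⟨r, s, hr, hs, hrs, rfl⟩⟩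
    refine ⟨r, s * c, s * d, hr, mul_nonneg hs hc, mul_nonneg hs hd, ?_, ?_⟩
    · linear_combination s * hcd + hrs
    · module
  · rintro ⟨u, v, w, hu, hv, hw, h, rfl⟩
    have key := (convex_convexHull ℝ {x, y, z}).sum_mem (t := Finset.univ)
      (w := ![u, v, w]) (z := ![x, y, z])
      (by simp [Fin.forall_fin_succ, hu, hv, hw]) (by simpa [Fin.sum_univ_three] using h)
      (fun i _ => subset_convexHull ℝ _ (by fin_cases i <;> simp))
    simpa [Fin.sum_univ_three] using key

/-- The map `(x, t) ↦ (x - t, x t)` sends the unit square onto the triangle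
`0 ≤ v`, `v - 1 ≤ u ≤ 1 - v`. -/
theorem exists_unitSquare_sub_mul_eq {u v : ℝ} (hv : 0 ≤ v) (h₁ : u + v ≤ 1) (h₂ : v - u ≤ 1) :
    ∃ x ∈ Set.Icc (0 : ℝ) 1, ∃ t ∈ Set.Icc (0 : ℝ) 1, x - t = u ∧ x * t = v := by
  set s := √(u ^ 2 + 4 * v)
  have hs : s ^ 2 = u ^ 2 + 4 * v := Real.sq_sqrt (by positivity)
  have hus : |u| ≤ s := Real.abs_le_sqrt (by linarith)
  obtain ⟨hl, hr⟩ := abs_le.mp hus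
  have hs₁ : s ≤ 2 - u := Real.sqrt_le_iff.mpr ⟨by linarith, by nlinarith⟩
  have hs₂ : s ≤ 2 + u := Real.sqrt_le_iff.mpr ⟨by linarith, by nlinarith⟩
  refine ⟨(s + u) / 2, ⟨by linarith, by linarith⟩, (s - u) / 2, ⟨by linarith, by linarith⟩,
    by ring, ?_⟩
  linear_combination hs / 4

/-- For `Δx, Δt > 0` and `b ∈ ℝ`, the image of the unit square under
`Ψ(x̃,t̃) = ((Δx/2)(x̃ − t̃) + b, (Δt/2) x̃ t̃)` is the closed triangle with
vertices `(b − Δx/2, 0)`, `(b + Δx/2, 0)`, `(b, Δt/2)`. -/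
theorem image_unitSquare_eq_scaled_triangle
    (Δx Δt : ℝ) (hΔx : 0 < Δx) (hΔt : 0 < Δt) (b : ℝ) :
    (fun p : ℝ × ℝ => (Δx / 2 * (p.1 - p.2) + b, Δt / 2 * (p.1 * p.2))) ''
        (Set.Icc (0 : ℝ) 1 ×ˢ Set.Icc (0 : ℝ) 1)
      = convexHull ℝ {((b - Δx / 2 : ℝ), (0 : ℝ)), (b + Δx / 2, 0), (b, Δt / 2)} := by
  ext q
  rw [mem_convexHull_triple]
  constructor
  · rintro ⟨⟨x, t⟩, ⟨⟨hx₀, hx₁⟩, ht₀, ht₁⟩, rfl⟩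
    dsimp only at hx₀ hx₁ ht₀ ht₁
    refine ⟨(1 - x) * (1 + t) / 2, (1 + x) * (1 - t) / 2, x * t, ?_, ?_, mul_nonneg hx₀ ht₀,
      by ring, ?_⟩
    · exact div_nonneg (mul_nonneg (by linarith) (by linarith)) (by norm_num)
    · exact div_nonneg (mul_nonneg (by linarith) (by linarith)) (by norm_num)
    · ext <;> simp <;> ring
  · rintro ⟨r, s, w, hr, hs, hw, h, rfl⟩
    obtain ⟨x, hx, t, ht, hu, hv⟩ :=
      exists_unitSquare_sub_mul_eq (u := s - r) hw (by linarith) (by linarith)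
    refine ⟨(x, t), ⟨hx, ht⟩, ?_⟩
    ext
    · simp only [hu, Prod.smul_mk, Prod.mk_add_mk, smul_eq_mul]
      linear_combination -b * h
    · simp only [hv, Prod.smul_mk, Prod.mk_add_mk, smul_eq_mul]
      ring
end
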